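/- The kernel of the group homomorphism φ : Br₃ → SL(2,ℤ) sending σ₁ to [[1,1],[0,1]] and σ₂ to [[1,0],[-1,1]] is the subgroup of Br₃ generated by the double full twist (σ₁σ₂)⁶. -/

import Mathlib

/-- The braid relation for the braid group on three strands, as a relation on the free group
on two generators: `σ₁σ₂σ₁(σ₂σ₁σ₂)⁻¹`. -/
def braidRels : Set (FreeGroup (Fin 2)) :=
  {FreeGroup.of 0 * FreeGroup.of 1 * FreeGroup.of 0 *
    (FreeGroup.of 1 * FreeGroup.of 0 * FreeGroup.of 1)⁻¹}

/-- The braid group on three strands, `Br₃ = ⟨σ₁, σ₂ ∣ σ₁σ₂σ₁ = σ₂σ₁σ₂⟩`. -/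
abbrev Br3 : Type := PresentedGroup braidRels

/-- The standard generators `σ₁`, `σ₂` of `Br₃`. -/
def σ (i : Fin 2) : Br3 := PresentedGroup.of i

/-- The matrix `A = [[1,1],[0,1]]` as an element of `SL(2,ℤ)`. -/
def Amat : Matrix.SpecialLinearGroup (Fin 2) ℤ :=
  ⟨!![1, 1; 0, 1], by norm_num [Matrix.det_fin_two_of]⟩

/-- The matrix `B = [[1,0],[-1,1]]` as an element of `SL(2,ℤ)`. -/
def Bmat : Matrix.SpecialLinearGroup (Fin 2) ℤ :=
  ⟨!![1, 0; -1, 1], by norm_num [Matrix.det_fin_two_of]⟩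

/-- Membership in the submonoid generated by `a` and `b⁻¹`, built up by left multiplication. -/
inductive IsPositiveWord {G : Type*} [Group G] (a b : G) : G → Prop
  | one : IsPositiveWord a b 1
  | mul {w : G} : IsPositiveWord a b w → IsPositiveWord a b (a * w)
  | inv_mul {w : G} : IsPositiveWord a b w → IsPositiveWord a b (b⁻¹ * w)

/-- The elements `Δⁱ * w * Δʲ` with `Δ = a * b * a` and `w` a positive word in `a` and `b⁻¹`. -/
def HasNormalForm {G : Type*} [Group G] (a b g : G) : Prop :=
  ∃ (i j : ℤ) (w : G), IsPositiveWord a b w ∧ g = (a * b * a) ^ i * w * (a * b * a) ^ j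

section BraidRelation

variable {G : Type*} [Group G] {a b : G}

theorem IsPositiveWord.hasNormalForm {w : G} (hw : IsPositiveWord a b w) :
    HasNormalForm a b w :=
  ⟨0, 0, w, hw, by simp⟩

theorem HasNormalForm.zpow_mul_mul_zpow {g : G} (hg : HasNormalForm a b g) (m n : ℤ) :
    HasNormalForm a b ((a * b * a) ^ m * g * (a * b * a) ^ n) := by
  obtain ⟨i, j, w, hw, rfl⟩ := hg
  exact ⟨m + i, j + n, w, hw, by simp only [zpow_add, mul_assoc]⟩

theorem HasNormalForm.garside_mul {g : G} (hg : HasNormalForm a b g) :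
    HasNormalForm a b (a * b * a * g) := by
  simpa using hg.zpow_mul_mul_zpow 1 0

theorem HasNormalForm.garside_inv_mul {g : G} (hg : HasNormalForm a b g) :
    HasNormalForm a b ((a * b * a)⁻¹ * g) := by
  simpa using hg.zpow_mul_mul_zpow (-1) 0

theorem left_mul_garside (h : a * b * a = b * a * b) : a * (a * b * a) = a * b * a * b := by
  rw [h]; simp only [← mul_assoc]; rw [h]

theorem right_mul_garside (h : a * b * a = b * a * b) : b * (a * b * a) = a * b * a * a := by
  simp only [← mul_assoc]; rw [h]

theorem commute_left_garside_sq (h : a * b * a = b * a * b) : Commute a ((a * b * a) ^ 2) := by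
  rw [commute_iff_eq, sq, ← mul_assoc, left_mul_garside h, mul_assoc _ b, right_mul_garside h,
    mul_assoc (a * b * a)]

theorem hasNormalForm_left_mul_garside_mul (h : a * b * a = b * a * b) {w : G}
    (hw : IsPositiveWord a b w) : HasNormalForm a b (a * (a * b * a * w)) := by
  cases hw with
  | one => exact ⟨0, 1, a * 1, .mul .one, by simp⟩
  | @mul w hw =>
    refine ⟨2, 0, b⁻¹ * w, .inv_mul hw, ?_⟩
    have : a * (a * b * a) * a = (a * b * a) * (a * b * a) * b⁻¹ := by
      rw [left_mul_garside h, eq_mul_inv_iff_mul_eq]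
      simp only [mul_assoc] at h ⊢
      rw [h]
    rw [zpow_ofNat, sq, zpow_zero, mul_one, ← mul_assoc, ← mul_assoc, this]
    simp only [mul_assoc]
  | @inv_mul w hw =>
    refine ⟨1, 0, w, hw, ?_⟩
    rw [← mul_assoc, ← mul_assoc, left_mul_garside h]
    simp

theorem hasNormalForm_left_inv_mul (h : a * b * a = b * a * b) {w : G}
    (hw : IsPositiveWord a b w) : HasNormalForm a b (a⁻¹ * w) := by
  cases hw with
  | one =>
    refine ⟨1, -1, b⁻¹ * 1, .inv_mul .one, ?_⟩
    rw [inv_mul_eq_iff_eq_mul, zpow_one, zpow_neg_one, mul_one, ← mul_assoc, ← mul_assoc,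
      left_mul_garside h]
    simp
  | @mul w hw => simpa using hw.hasNormalForm
  | @inv_mul w hw =>
    refine ⟨-1, 0, a * w, .mul hw, ?_⟩
    group

theorem hasNormalForm_left_inv_mul_garside_mul (h : a * b * a = b * a * b) {w : G}
    (hw : IsPositiveWord a b w) : HasNormalForm a b (a⁻¹ * (a * b * a * w)) := by
  refine ⟨1, 0, b⁻¹ * w, .inv_mul hw, ?_⟩
  rw [inv_mul_eq_iff_eq_mul, zpow_one, zpow_zero, mul_one, ← mul_assoc, ← mul_assoc,
    left_mul_garside h]
  simp

/-- It suffices to check left multiplication on `w` and `Δ * w`, as `Δ²` commutes with `x`. -/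
theorem HasNormalForm.mul_left_of_commute {x g : G} (hx : Commute x ((a * b * a) ^ 2))
    (h₀ : ∀ w, IsPositiveWord a b w → HasNormalForm a b (x * w))
    (h₁ : ∀ w, IsPositiveWord a b w → HasNormalForm a b (x * (a * b * a * w)))
    (hg : HasNormalForm a b g) : HasNormalForm a b (x * g) := by
  obtain ⟨i, j, w, hw, rfl⟩ := hg
  have hc (k : ℤ) : x * (a * b * a) ^ (2 * k) = (a * b * a) ^ (2 * k) * x := by
    rw [zpow_mul, zpow_ofNat]
    exact (hx.zpow_right k).eq
  obtain ⟨k, rfl | rfl⟩ := i.even_or_odd'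
  · convert (h₀ w hw).zpow_mul_mul_zpow (2 * k) j using 1
    rw [← mul_assoc, ← mul_assoc, hc, mul_assoc _ x]
  · convert (h₁ w hw).zpow_mul_mul_zpow (2 * k) j using 1
    rw [zpow_add, zpow_one, ← mul_assoc, ← mul_assoc, ← mul_assoc, hc]
    simp only [mul_assoc]

theorem HasNormalForm.left_mul (h : a * b * a = b * a * b) {g : G} (hg : HasNormalForm a b g) :
    HasNormalForm a b (a * g) :=
  hg.mul_left_of_commute (commute_left_garside_sq h) (fun _ hw => hw.mul.hasNormalForm)
    fun _ hw => hasNormalForm_left_mul_garside_mul h hw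

theorem HasNormalForm.left_inv_mul (h : a * b * a = b * a * b) {g : G}
    (hg : HasNormalForm a b g) : HasNormalForm a b (a⁻¹ * g) :=
  hg.mul_left_of_commute (commute_left_garside_sq h).inv_left
    (fun _ hw => hasNormalForm_left_inv_mul h hw)
    fun _ hw => hasNormalForm_left_inv_mul_garside_mul h hw

theorem hasNormalForm_of_mem_closure (h : a * b * a = b * a * b) {g : G}
    (hg : g ∈ Subgroup.closure {a, b}) : HasNormalForm a b g := by
  have hb : b = a * b * a * a * (a * b * a)⁻¹ := by
    rw [eq_mul_inv_iff_mul_eq, right_mul_garside h]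
  induction hg using Subgroup.closure_induction_left with
  | one => exact IsPositiveWord.one.hasNormalForm
  | mul_left x hx y _ ih =>
    obtain rfl | rfl := hx
    · exact ih.left_mul h
    · have := (ih.garside_inv_mul.left_mul h).garside_mul
      rwa [← mul_assoc, ← mul_assoc, ← hb] at this
  | inv_mul_cancel x hx y _ ih =>
    obtain rfl | rfl := hx
    · exact ih.left_inv_mul h
    · have := (ih.garside_inv_mul.left_inv_mul h).garside_mul
      rwa [← mul_assoc, ← mul_assoc,
        show a * x * a * a⁻¹ * (a * x * a)⁻¹ = x⁻¹ by
          conv_rhs => rw [hb]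
          simp only [mul_inv_rev, inv_inv, mul_assoc]] at this

theorem garside_pow_four (h : a * b * a = b * a * b) : (a * b * a) ^ 4 = (a * b) ^ 6 := by
  have hsq : (a * b * a) ^ 2 = (a * b) ^ 3 := by
    rw [sq]
    nth_rw 2 [h]
    simp only [pow_succ, pow_zero, one_mul, mul_assoc]
  rw [show 4 = 2 * 2 from rfl, pow_mul, hsq, ← pow_mul]

end BraidRelation

theorem Amat_mul_apply_zero (M : Matrix.SpecialLinearGroup (Fin 2) ℤ) (j : Fin 2) :
    (Amat * M) 0 j = M 0 j + M 1 j := by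
  rw [Matrix.SpecialLinearGroup.coe_mul]
  simp [Amat, Matrix.mul_apply, Fin.sum_univ_two]

theorem Amat_mul_apply_one (M : Matrix.SpecialLinearGroup (Fin 2) ℤ) (j : Fin 2) :
    (Amat * M) 1 j = M 1 j := by
  rw [Matrix.SpecialLinearGroup.coe_mul]
  simp [Amat, Matrix.mul_apply, Fin.sum_univ_two]

theorem coe_Bmat_inv :
    ((Bmat⁻¹ : Matrix.SpecialLinearGroup (Fin 2) ℤ) : Matrix (Fin 2) (Fin 2) ℤ) =
      !![1, 0; 1, 1] := by
  rw [Matrix.SpecialLinearGroup.coe_inv, Matrix.adjugate_fin_two]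
  simp [Bmat]

theorem Bmat_inv_mul_apply_zero (M : Matrix.SpecialLinearGroup (Fin 2) ℤ) (j : Fin 2) :
    (Bmat⁻¹ * M) 0 j = M 0 j := by
  rw [Matrix.SpecialLinearGroup.coe_mul, coe_Bmat_inv]
  simp [Matrix.mul_apply, Fin.sum_univ_two]

theorem Bmat_inv_mul_apply_one (M : Matrix.SpecialLinearGroup (Fin 2) ℤ) (j : Fin 2) :
    (Bmat⁻¹ * M) 1 j = M 0 j + M 1 j := by
  rw [Matrix.SpecialLinearGroup.coe_mul, coe_Bmat_inv]
  simp [Matrix.mul_apply, Fin.sum_univ_two]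

theorem garside_matrix_pow_four : (Amat * Bmat * Amat) ^ 4 = 1 := by
  decide

/-- A power of `ABA` whose entries are nonnegative is trivial. -/
theorem four_dvd_of_garside_matrix_zpow_nonneg {n : ℤ}
    (hn : ∀ i j, 0 ≤ ((Amat * Bmat * Amat) ^ n) i j) : 4 ∣ n := by
  have hmod : (Amat * Bmat * Amat) ^ n = (Amat * Bmat * Amat) ^ (n % 4) :=
    zpow_eq_zpow_emod' n garside_matrix_pow_four
  rw [hmod] at hn
  have h0 : 0 ≤ n % 4 := Int.emod_nonneg _ (by decide)
  have h4 : n % 4 < 4 := Int.emod_lt_of_pos _ (by decide)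
  apply Int.dvd_of_emod_eq_zero
  have h01 := hn 0 1
  have h10 := hn 1 0
  have h00 := hn 0 0
  generalize n % 4 = m at h0 h4 h00 h01 h10 ⊢
  interval_cases m
  · rfl
  · exact absurd h10 (by decide)
  · exact absurd h00 (by decide)
  · exact absurd h01 (by decide)

section Image

variable {G : Type*} [Group G] {a b w : G} {φ : G →* Matrix.SpecialLinearGroup (Fin 2) ℤ}

theorem IsPositiveWord.map_nonneg (ha : φ a = Amat) (hb : φ b = Bmat)
    (hw : IsPositiveWord a b w) (i j : Fin 2) : 0 ≤ φ w i j := by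
  induction hw generalizing i j with
  | one => rw [map_one]; fin_cases i <;> fin_cases j <;> decide
  | mul _ ih =>
    rw [map_mul, ha]
    fin_cases i
    · exact (Amat_mul_apply_zero _ j).symm ▸ add_nonneg (ih 0 j) (ih 1 j)
    · exact (Amat_mul_apply_one _ j).symm ▸ ih 1 j
  | inv_mul _ ih =>
    rw [map_mul, map_inv, hb]
    fin_cases i
    · exact (Bmat_inv_mul_apply_zero _ j).symm ▸ ih 0 j
    · exact (Bmat_inv_mul_apply_one _ j).symm ▸ add_nonneg (ih 0 j) (ih 1 j)

theorem IsPositiveWord.eq_one_of_map_eq_one (ha : φ a = Amat) (hb : φ b = Bmat)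
    (hw : IsPositiveWord a b w) (h : φ w = 1) : w = 1 := by
  cases hw with
  | one => rfl
  | @mul w hw =>
    rw [map_mul, ha] at h
    have h01 := Amat_mul_apply_zero (φ w) 1
    have h11 := Amat_mul_apply_one (φ w) 1
    have := hw.map_nonneg ha hb 0 1
    simp [h] at h01 h11
    omega
  | @inv_mul w hw =>
    rw [map_mul, map_inv, hb] at h
    have h00 := Bmat_inv_mul_apply_zero (φ w) 0
    have h10 := Bmat_inv_mul_apply_one (φ w) 0
    have := hw.map_nonneg ha hb 1 0
    simp [h] at h00 h10
    omega

end Image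

theorem σ_braid_relation : σ 0 * σ 1 * σ 0 = σ 1 * σ 0 * σ 1 :=
  mul_inv_eq_one.mp (PresentedGroup.one_of_mem (rels := braidRels) (Set.mem_singleton _))

theorem closure_σ : Subgroup.closure {σ 0, σ 1} = ⊤ := by
  rw [← PresentedGroup.closure_range_of braidRels]
  congr 1
  ext x
  simp [σ, Fin.exists_fin_two, eq_comm]

/-- The kernel of the homomorphism `φ : Br₃ → SL(2,ℤ)` with `φ(σ₁) = A`, `φ(σ₂) = B` is
the subgroup of `Br₃` generated by the double full twist `(σ₁σ₂)⁶`. -/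
theorem ker_br3_to_SL2Z_eq_closure_double_full_twist
    (φ : Br3 →* Matrix.SpecialLinearGroup (Fin 2) ℤ)
    (h1 : φ (σ 0) = Amat) (h2 : φ (σ 1) = Bmat) :
    φ.ker = Subgroup.closure {(σ 0 * σ 1) ^ 6} := by
  have hΔ : φ (σ 0 * σ 1 * σ 0) = Amat * Bmat * Amat := by simp only [map_mul, h1, h2]
  rw [← garside_pow_four σ_braid_relation]
  apply le_antisymm
  · intro g hg
    obtain ⟨i, j, w, hw, rfl⟩ := hasNormalForm_of_mem_closure σ_braid_relation
      (closure_σ ▸ Subgroup.mem_top g)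
    rw [MonoidHom.mem_ker, map_mul, map_mul, map_zpow, map_zpow, hΔ, mul_eq_one_iff_eq_inv,
      ← zpow_neg, ← eq_inv_mul_iff_mul_eq, ← zpow_neg, ← zpow_add] at hg
    obtain ⟨k, hk⟩ := four_dvd_of_garside_matrix_zpow_nonneg
      fun p q => hg ▸ hw.map_nonneg h1 h2 p q
    have hw1 : w = 1 := hw.eq_one_of_map_eq_one h1 h2 <| by
      rw [hg, hk, zpow_mul, zpow_ofNat, garside_matrix_pow_four, one_zpow]
    rw [Subgroup.mem_closure_singleton]
    refine ⟨-k, ?_⟩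
    rw [hw1, mul_one, ← zpow_add, ← zpow_natCast, ← zpow_mul]
    congr 1
    push_cast
    omega
  · rw [Subgroup.closure_le, Set.singleton_subset_iff, SetLike.mem_coe, MonoidHom.mem_ker,
      map_pow, hΔ, garside_matrix_pow_four]
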